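/- (Weak monotonicity) Let v and ṽ be complete Llull matrices on a finite set A and let a ∈ A be such that ṽ_{ay} ≥ v_{ay} and ṽ_{xa} ≤ v_{xa} for all x, y ≠ a, and ṽ_{xy} = v_{xy} for all x, y ≠ a. Let v*, R and ṽ*, R̃ denote the corresponding indirect scores and rank-like rates. Then: (i) ṽ*_{ay} ≥ v*_{ay} and ṽ*_{xa} ≤ v*_{xa} for all x, y ≠ a; (ii) for every y ≠ a, R_a < R_y implies R̃_a ≤ R̃_y; and (iii) if R_a < R_y for all y ≠ a, then R̃_a < R̃_y for all y ≠ a. -/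

import Mathlib

/-! Common definitions: valued relations, indirect scores, admissible orders,
projected margins/scores, rank-like rates (Camps–Mora–Saumell CLC method). -/

variable {A : Type*} [Fintype A] [DecidableEq A]

/-- The score of a chain `x₀ :: x₁ :: ... :: xₙ`: the minimum of `v xᵢ xᵢ₊₁`
over its links (value `1` for chains with no link, which we never use). -/
noncomputable def linkScore (v : A → A → ℝ) : List A → ℝ
  | [] => 1
  | [_] => 1
  | [a, b] => v a b
  | a :: b :: c :: l => min (v a b) (linkScore v (b :: c :: l))

/-- The indirect score `v*_{xy}`: the supremum (= maximum) of the scores of all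
paths from `x` to `y` (with at least one link, consecutive elements distinct). -/
noncomputable def istar (v : A → A → ℝ) (x y : A) : ℝ :=
  sSup { s : ℝ | ∃ l : List A, List.Chain' (· ≠ ·) (x :: (l ++ [y])) ∧
      s = linkScore v (x :: (l ++ [y])) }

/-- `ξ` is a strict total order: irreflexive, transitive, total. -/
def StrictTotal (ξ : A → A → Prop) : Prop :=
  (∀ x, ¬ ξ x x) ∧ (∀ x y z, ξ x y → ξ y z → ξ x z) ∧ (∀ x y, x ≠ y → ξ x y ∨ ξ y x)

/-- `ξ` is admissible for `v`: `v*_{xy} > v*_{yx}` implies `x` precedes `y`. -/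
def Adm (v : A → A → ℝ) (ξ : A → A → Prop) : Prop :=
  ∀ x y, istar v x y > istar v y x → ξ x y

/-- Intermediate projected margin `m^σ_{xy}` (for `x` preceding `y` in `ξ`):
the infimum (= minimum) of the indirect margins `m*_{pq}` over `p ⪯ x`, `y ⪯ q`. -/
noncomputable def msigma (v : A → A → ℝ) (ξ : A → A → Prop) (x y : A) : ℝ :=
  sInf { s : ℝ | ∃ p q, (ξ p x ∨ p = x) ∧ (ξ y q ∨ q = y) ∧
      s = istar v p q - istar v q p }

/-- `q` is the immediate successor of `p` in `ξ`. -/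
def ImmSucc (ξ : A → A → Prop) (p q : A) : Prop :=
  ξ p q ∧ ∀ z, ¬ (ξ p z ∧ ξ z q)

/-- Projected margin (for `x` preceding `y` in `ξ`): the supremum (= maximum) of
`m^σ_{p p'}` over `x ⪯ p ≺ y`, `p'` the immediate successor of `p`. -/
noncomputable def mpiAux (v : A → A → ℝ) (ξ : A → A → Prop) (x y : A) : ℝ :=
  sSup { s : ℝ | ∃ p q, (ξ x p ∨ p = x) ∧ ξ p y ∧ ImmSucc ξ p q ∧
      s = msigma v ξ p q }

open Classical in
/-- Projected margins `m^π`, extended antisymmetrically. -/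
noncomputable def mpi (v : A → A → ℝ) (ξ : A → A → Prop) (x y : A) : ℝ :=
  if ξ x y then mpiAux v ξ x y else - mpiAux v ξ y x

/-- Projected scores `v^π_{xy} = (1 + m^π_{xy})/2`. -/
noncomputable def vpi (v : A → A → ℝ) (ξ : A → A → Prop) (x y : A) : ℝ :=
  (1 + mpi v ξ x y) / 2

/-- Rank-like rate `R_x = N - ∑_{y ≠ x} v^π_{xy}`. -/
noncomputable def rlr (v : A → A → ℝ) (ξ : A → A → Prop) (x : A) : ℝ :=
  (Fintype.card A : ℝ) - ∑ y ∈ Finset.univ.erase x, vpi v ξ x y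

/-- `v` is a complete Llull matrix: scores of distinct pairs lie in `[0,1]`
and satisfy `v_{xy} + v_{yx} = 1`. -/
def Llull (v : A → A → ℝ) : Prop :=
  ∀ x y : A, x ≠ y → 0 ≤ v x y ∧ v x y ≤ 1 ∧ v x y + v y x = 1

section IndirectScores

variable {α : Type*} {v w : α → α → ℝ}

theorem linkScore_le_one (hv : Llull v) :
    ∀ l : List α, List.IsChain (· ≠ ·) l → linkScore v l ≤ 1
  | [], _ => le_rfl
  | [_], _ => le_rfl
  | [a, b], h => (hv a b (by simpa using h)).2.1
  | _ :: b :: c :: l, h =>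
    (min_le_right _ _).trans (linkScore_le_one hv (b :: c :: l) (List.isChain_cons_cons.1 h).2)

theorem linkScore_cons_append (x z y : α) (l : List α) :
    linkScore v (x :: z :: (l ++ [y])) = min (v x z) (linkScore v (z :: (l ++ [y]))) := by
  cases l <;> rfl

theorem transGen_of_le_linkScore {s : ℝ} {y : α} (l : List α) (x : α)
    (hl : List.IsChain (· ≠ ·) (x :: (l ++ [y]))) (hs : s ≤ linkScore v (x :: (l ++ [y]))) :
    Relation.TransGen (fun p q => p ≠ q ∧ s ≤ v p q) x y := by
  induction l generalizing x with
  | nil => exact .single ⟨by simpa using hl, hs⟩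
  | cons z l ih =>
    simp only [List.cons_append, List.isChain_cons_cons] at hl
    rw [List.cons_append, linkScore_cons_append, le_min_iff] at hs
    exact .head ⟨hl.1, hs.1⟩ (ih z hl.2 hs.2)

theorem exists_le_linkScore_of_transGen {s : ℝ} {x y : α}
    (h : Relation.TransGen (fun p q => p ≠ q ∧ s ≤ v p q) x y) :
    ∃ l : List α, List.IsChain (· ≠ ·) (x :: (l ++ [y])) ∧
      s ≤ linkScore v (x :: (l ++ [y])) := by
  induction h using Relation.TransGen.head_induction_on with
  | single h => exact ⟨[], by simpa using h.1, h.2⟩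
  | @head x z h _ ih =>
    obtain ⟨l, hl, hs⟩ := ih
    refine ⟨z :: l, ?_, ?_⟩
    · simpa only [List.cons_append, List.isChain_cons_cons] using ⟨h.1, hl⟩
    · rw [List.cons_append, linkScore_cons_append]
      exact le_min h.2 hs

theorem istar_le_istar (hw : Llull w) {x y : α} (hxy : x ≠ y)
    (H : ∀ s : ℝ, Relation.TransGen (fun p q => p ≠ q ∧ s ≤ v p q) x y →
      Relation.TransGen (fun p q => p ≠ q ∧ s ≤ w p q) x y) :
    istar v x y ≤ istar w x y := by
  refine csSup_le ⟨_, [], List.isChain_pair.2 hxy, rfl⟩ ?_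
  rintro s ⟨l, hl, hs⟩
  obtain ⟨l', hl', hs'⟩ :=
    exists_le_linkScore_of_transGen (H s (transGen_of_le_linkScore l x hl hs.le))
  refine hs'.trans (le_csSup ⟨1, ?_⟩ ⟨l', hl', rfl⟩)
  rintro _ ⟨m, hm, rfl⟩
  exact linkScore_le_one hw _ hm

theorem istar_le_istar_left (hw : Llull w) {a : α} (h1 : ∀ y, y ≠ a → v a y ≤ w a y)
    (h3 : ∀ x y, x ≠ a → y ≠ a → x ≠ y → w x y = v x y) {y : α} (hy : y ≠ a) :
    istar v a y ≤ istar w a y := by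
  refine istar_le_istar hw hy.symm fun s h => ?_
  have step : ∀ {b c}, b ≠ c → c ≠ a → s ≤ v b c → s ≤ w b c := fun {b c} hbc hc hs => by
    by_cases hb : b = a
    · subst hb; exact hs.trans (h1 c hc)
    · rwa [h3 b c hb hc hbc]
  have key : y = a ∨ Relation.TransGen (fun p q => p ≠ q ∧ s ≤ w p q) a y := by
    clear hy
    induction h with
    | @single c h =>
      by_cases hc : c = a
      · exact .inl hc
      · exact .inr (.single ⟨h.1, step h.1 hc h.2⟩)
    | @tail b c _ h ih =>
      by_cases hc : c = a
      · exact .inl hc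
      have hl := And.intro h.1 (step h.1 hc h.2)
      rcases ih with rfl | ih
      · exact .inr (.single hl)
      · exact .inr (ih.tail hl)
  exact key.resolve_left hy

theorem istar_le_istar_right (hv : Llull v) {a : α} (h2 : ∀ x, x ≠ a → w x a ≤ v x a)
    (h3 : ∀ x y, x ≠ a → y ≠ a → x ≠ y → w x y = v x y) {x : α} (hx : x ≠ a) :
    istar w x a ≤ istar v x a := by
  refine istar_le_istar hv hx fun s h => ?_
  have step : ∀ {b c}, b ≠ c → b ≠ a → s ≤ w b c → s ≤ v b c := fun {b c} hbc hb hs => by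
    by_cases hc : c = a
    · subst hc; exact hs.trans (h2 b hb)
    · rwa [← h3 b c hb hc hbc]
  have key : x = a ∨ Relation.TransGen (fun p q => p ≠ q ∧ s ≤ v p q) x a := by
    clear hx
    induction h using Relation.TransGen.head_induction_on with
    | @single b h =>
      by_cases hb : b = a
      · exact .inl hb
      · exact .inr (.single ⟨h.1, step h.1 hb h.2⟩)
    | @head b c h _ ih =>
      by_cases hb : b = a
      · exact .inl hb
      have hl := And.intro h.1 (step h.1 hb h.2)
      rcases ih with rfl | ih
      · exact .inr (.single hl)
      · exact .inr (ih.head hl)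
  exact key.resolve_left hx

end IndirectScores

section ProjectedMargins

variable {α : Type*} {v : α → α → ℝ} {ξ : α → α → Prop}

theorem StrictTotal.asymm (hξ : StrictTotal ξ) {x y : α} (h : ξ x y) : ¬ ξ y x :=
  fun h' => hξ.1 x (hξ.2.1 _ _ _ h h')

theorem StrictTotal.ne (hξ : StrictTotal ξ) {x y : α} (h : ξ x y) : x ≠ y := by
  rintro rfl
  exact hξ.1 x h

theorem StrictTotal.of_le_of_lt (hξ : StrictTotal ξ) {x y z : α} (h : ξ x y ∨ x = y)
    (h' : ξ y z) : ξ x z := by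
  rcases h with h | rfl
  · exact hξ.2.1 _ _ _ h h'
  · exact h'

theorem StrictTotal.of_lt_of_le (hξ : StrictTotal ξ) {x y z : α} (h : ξ x y)
    (h' : ξ y z ∨ z = y) : ξ x z := by
  rcases h' with h' | rfl
  · exact hξ.2.1 _ _ _ h h'
  · exact h

theorem StrictTotal.immSucc_le (hξ : StrictTotal ξ) {p q y : α} (h : ImmSucc ξ p q)
    (hy : ξ p y) : ξ q y ∨ y = q := by
  by_cases hq : y = q
  · exact .inr hq
  · exact (hξ.2.2 y q hq).elim (fun h' => (h.2 y ⟨hy, h'⟩).elim) .inl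

theorem StrictTotal.exists_immSucc [Finite α] (hξ : StrictTotal ξ) {x y : α} (h : ξ x y) :
    ∃ z, ImmSucc ξ x z := by
  have : IsTrans α ξ := ⟨hξ.2.1⟩
  have : Std.Irrefl ξ := ⟨hξ.1⟩
  obtain ⟨z, hz, hmin⟩ := (Finite.wellFounded_of_trans_of_irrefl ξ).has_min {z | ξ x z} ⟨y, h⟩
  exact ⟨z, hz, fun u hu => hmin u hu.1 hu.2⟩

theorem finite_msigma_set [Finite α] (x y : α) :
    { s : ℝ | ∃ p q, (ξ p x ∨ p = x) ∧ (ξ y q ∨ q = y) ∧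
      s = istar v p q - istar v q p }.Finite := by
  refine (Set.finite_range fun r : α × α => istar v r.1 r.2 - istar v r.2 r.1).subset ?_
  rintro _ ⟨p, q, -, -, rfl⟩
  exact ⟨(p, q), rfl⟩

theorem msigma_le [Finite α] {x y p q : α} (hp : ξ p x ∨ p = x) (hq : ξ y q ∨ q = y) :
    msigma v ξ x y ≤ istar v p q - istar v q p :=
  csInf_le (finite_msigma_set x y).bddBelow ⟨p, q, hp, hq, rfl⟩

theorem msigma_pos [Finite α] {x y : α}
    (h : ∀ p q, (ξ p x ∨ p = x) → (ξ y q ∨ q = y) → istar v q p < istar v p q) :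
    0 < msigma v ξ x y := by
  have hfin := finite_msigma_set (v := v) (ξ := ξ) x y
  have hne : _ ∈ { s : ℝ | ∃ p q, (ξ p x ∨ p = x) ∧ (ξ y q ∨ q = y) ∧
      s = istar v p q - istar v q p } := ⟨x, y, .inr rfl, .inr rfl, rfl⟩
  obtain ⟨p, q, hp, hq, hs⟩ := Set.Nonempty.csInf_mem ⟨_, hne⟩ hfin
  exact (sub_pos.2 (h p q hp hq)).trans_eq hs.symm

theorem msigma_nonneg (hξ : StrictTotal ξ) (hadm : Adm v ξ) {x y : α} (h : ξ x y) :
    0 ≤ msigma v ξ x y := by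
  refine Real.sInf_nonneg ?_
  rintro _ ⟨p, q, hp, hq, rfl⟩
  by_contra! hlt
  exact hξ.asymm (hξ.of_le_of_lt hp (hξ.of_lt_of_le h hq)) (hadm q p (sub_neg.1 hlt))

theorem mpiAux_nonneg (hξ : StrictTotal ξ) (hadm : Adm v ξ) (x y : α) :
    0 ≤ mpiAux v ξ x y := by
  refine Real.sSup_nonneg ?_
  rintro _ ⟨p, q, -, -, hpq, rfl⟩
  exact msigma_nonneg hξ hadm hpq.1

theorem le_mpiAux [Finite α] {x y p q : α} (hp : ξ x p ∨ p = x) (hy : ξ p y)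
    (hpq : ImmSucc ξ p q) : msigma v ξ p q ≤ mpiAux v ξ x y := by
  refine le_csSup (Set.Finite.bddAbove ?_) ⟨p, q, hp, hy, hpq, rfl⟩
  refine (Set.finite_range fun r : α × α => msigma v ξ r.1 r.2).subset ?_
  rintro _ ⟨p, q, -, -, -, rfl⟩
  exact ⟨(p, q), rfl⟩

theorem mpiAux_eq_max [Finite α] (hξ : StrictTotal ξ) (hadm : Adm v ξ) {x y z : α}
    (hxy : ξ x y) (hyz : ξ y z) :
    mpiAux v ξ x z = max (mpiAux v ξ x y) (mpiAux v ξ y z) := by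
  apply le_antisymm
  · refine Real.sSup_le ?_ ((mpiAux_nonneg hξ hadm x y).trans (le_max_left _ _))
    rintro _ ⟨p, q, hp, hz, hpq, rfl⟩
    by_cases hpy : ξ p y
    · exact (le_mpiAux hp hpy hpq).trans (le_max_left _ _)
    · have hyp : ξ y p ∨ p = y := by
        by_cases h : p = y
        · exact .inr h
        · exact .inl ((hξ.2.2 p y h).resolve_left hpy)
      exact (le_mpiAux hyp hz hpq).trans (le_max_right _ _)
  · refine max_le (Real.sSup_le ?_ (mpiAux_nonneg hξ hadm x z))
      (Real.sSup_le ?_ (mpiAux_nonneg hξ hadm x z))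
    · rintro _ ⟨p, q, hp, hy, hpq, rfl⟩
      exact le_mpiAux hp (hξ.2.1 _ _ _ hy hyz) hpq
    · rintro _ ⟨p, q, hp, hz, hpq, rfl⟩
      exact le_mpiAux (.inl (hξ.of_lt_of_le hxy hp)) hz hpq

theorem istar_lt_of_mpiAux_pos [Finite α] (hξ : StrictTotal ξ) {x y : α}
    (h : 0 < mpiAux v ξ x y) : istar v y x < istar v x y := by
  contrapose! h
  refine Real.sSup_nonpos ?_
  rintro _ ⟨p, q, hp, hy, hpq, rfl⟩
  exact (msigma_le (hp.imp_right Eq.symm) (hξ.immSucc_le hpq hy)).trans (sub_nonpos.2 h)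

theorem mpi_of_lt {x y : α} (h : ξ x y) : mpi v ξ x y = mpiAux v ξ x y := if_pos h

theorem mpi_of_gt (hξ : StrictTotal ξ) {x y : α} (h : ξ y x) :
    mpi v ξ x y = -mpiAux v ξ y x := if_neg (hξ.asymm h)

theorem mpi_anti [Finite α] (hξ : StrictTotal ξ) (hadm : Adm v ξ) {x y z : α} (hxy : ξ x y)
    (hzx : z ≠ x) (hzy : z ≠ y) : mpi v ξ y z ≤ mpi v ξ x z := by
  rcases hξ.2.2 z x hzx with h | h
  · rw [mpi_of_gt hξ h, mpi_of_gt hξ (hξ.2.1 _ _ _ h hxy), mpiAux_eq_max hξ hadm h hxy]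
    exact neg_le_neg (le_max_left _ _)
  rcases hξ.2.2 z y hzy with h' | h'
  · rw [mpi_of_lt h, mpi_of_gt hξ h']
    linarith [mpiAux_nonneg hξ hadm z y, mpiAux_nonneg hξ hadm x z]
  · rw [mpi_of_lt h, mpi_of_lt h', mpiAux_eq_max hξ hadm hxy h']
    exact le_max_right _ _

theorem mpi_eq_of_mpiAux_eq_zero [Finite α] (hξ : StrictTotal ξ) (hadm : Adm v ξ) {x y z : α}
    (hxy : ξ x y) (hzx : z ≠ x) (hzy : z ≠ y) (h0 : mpiAux v ξ x y = 0) :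
    mpi v ξ y z = mpi v ξ x z := by
  rcases hξ.2.2 z x hzx with h | h
  · rw [mpi_of_gt hξ h, mpi_of_gt hξ (hξ.2.1 _ _ _ h hxy), mpiAux_eq_max hξ hadm h hxy, h0,
      max_eq_left (mpiAux_nonneg hξ hadm z x)]
  rcases hξ.2.2 z y hzy with h' | h'
  · rw [mpi_of_lt h, mpi_of_gt hξ h']
    have hm := mpiAux_eq_max hξ hadm h h'
    have hl := le_max_left (mpiAux v ξ x z) (mpiAux v ξ z y)
    have hr := le_max_right (mpiAux v ξ x z) (mpiAux v ξ z y)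
    linarith [mpiAux_nonneg hξ hadm z y, mpiAux_nonneg hξ hadm x z]
  · rw [mpi_of_lt h, mpi_of_lt h', mpiAux_eq_max hξ hadm hxy h', h0,
      max_eq_right (mpiAux_nonneg hξ hadm y z)]

variable [Fintype α] [DecidableEq α]

theorem rlr_sub_rlr (hξ : StrictTotal ξ) {x y : α} (hxy : ξ x y) :
    rlr v ξ y - rlr v ξ x = mpiAux v ξ x y +
      ∑ z ∈ (Finset.univ.erase x).erase y, (mpi v ξ x z - mpi v ξ y z) / 2 := by
  have hne := hξ.ne hxy
  have hx := Finset.add_sum_erase (Finset.univ.erase x) (vpi v ξ x)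
    (Finset.mem_erase.2 ⟨hne.symm, Finset.mem_univ y⟩)
  have hy := Finset.add_sum_erase (Finset.univ.erase y) (vpi v ξ y)
    (Finset.mem_erase.2 ⟨hne, Finset.mem_univ x⟩)
  rw [Finset.erase_right_comm] at hy
  have hd : ∑ z ∈ (Finset.univ.erase x).erase y, (mpi v ξ x z - mpi v ξ y z) / 2 =
      ∑ z ∈ (Finset.univ.erase x).erase y, vpi v ξ x z -
        ∑ z ∈ (Finset.univ.erase x).erase y, vpi v ξ y z := by
    rw [← Finset.sum_sub_distrib]
    exact Finset.sum_congr rfl fun z _ => by unfold vpi; ring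
  have h1 : vpi v ξ x y = (1 + mpiAux v ξ x y) / 2 := by rw [vpi, mpi_of_lt hxy]
  have h2 : vpi v ξ y x = (1 - mpiAux v ξ x y) / 2 := by
    rw [vpi, mpi_of_gt hξ hxy, ← sub_eq_add_neg]
  unfold rlr
  linarith

theorem mpiAux_le_rlr_sub_rlr (hξ : StrictTotal ξ) (hadm : Adm v ξ) {x y : α} (hxy : ξ x y) :
    mpiAux v ξ x y ≤ rlr v ξ y - rlr v ξ x := by
  rw [rlr_sub_rlr hξ hxy]
  refine le_add_of_nonneg_right (Finset.sum_nonneg fun z hz => ?_)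
  simp only [Finset.mem_erase, Finset.mem_univ, and_true] at hz
  linarith [mpi_anti hξ hadm hxy hz.2 hz.1]

theorem rlr_lt_rlr_iff (hξ : StrictTotal ξ) (hadm : Adm v ξ) {x y : α} (hxy : ξ x y) :
    rlr v ξ x < rlr v ξ y ↔ 0 < mpiAux v ξ x y := by
  refine ⟨fun h => ?_, fun h => by linarith [mpiAux_le_rlr_sub_rlr hξ hadm hxy]⟩
  refine (mpiAux_nonneg hξ hadm x y).lt_of_ne fun h0 => ?_
  have hsub := rlr_sub_rlr (v := v) hξ hxy
  rw [Finset.sum_eq_zero fun z hz => ?_] at hsub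
  · linarith
  · simp only [Finset.mem_erase, Finset.mem_univ, and_true] at hz
    rw [mpi_eq_of_mpiAux_eq_zero hξ hadm hxy hz.2 hz.1 h0.symm, sub_self, zero_div]

theorem istar_lt_of_rlr_lt (hξ : StrictTotal ξ) (hadm : Adm v ξ) {x y : α}
    (h : rlr v ξ x < rlr v ξ y) : istar v y x < istar v x y := by
  have hne : x ≠ y := by
    rintro rfl
    exact h.false
  rcases hξ.2.2 x y hne with hxy | hyx
  · exact istar_lt_of_mpiAux_pos hξ ((rlr_lt_rlr_iff hξ hadm hxy).1 h)
  · linarith [mpiAux_le_rlr_sub_rlr hξ hadm hyx, mpiAux_nonneg hξ hadm y x]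

theorem rlr_lt_of_forall_istar_lt (hξ : StrictTotal ξ) (hadm : Adm v ξ) {a : α}
    (h : ∀ y, y ≠ a → istar v y a < istar v a y) {y : α} (hy : y ≠ a) :
    rlr v ξ a < rlr v ξ y := by
  have hlt : ∀ z, z ≠ a → ξ a z := fun z hz => hadm a z (h z hz)
  obtain ⟨b, hb⟩ := hξ.exists_immSucc (hlt y hy)
  refine (rlr_lt_rlr_iff hξ hadm (hlt y hy)).2
    ((msigma_pos fun p q hp hq => ?_).trans_le (le_mpiAux (.inr rfl) (hlt y hy) hb))
  obtain rfl : p = a := by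
    by_contra hpa
    exact hξ.asymm (hlt p hpa) (hp.resolve_right hpa)
  exact h q (hξ.ne (hξ.of_lt_of_le hb.1 hq)).symm

end ProjectedMargins

/-- Weak monotonicity: If `w` is obtained from `v` by raising
option `a` (i.e. `w_{ay} ≥ v_{ay}`, `w_{xa} ≤ v_{xa}`, all other scores
unchanged), then: (i) `w*_{ay} ≥ v*_{ay}` and `w*_{xa} ≤ v*_{xa}`;
(ii) `R_a < R_y` implies `R̃_a ≤ R̃_y`; (iii) if `R_a < R_y` for all `y ≠ a`,
then `R̃_a < R̃_y` for all `y ≠ a`. -/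
theorem stmt19 {A : Type*} [Fintype A] [DecidableEq A] (v w : A → A → ℝ)
    (hv : Llull v) (hw : Llull w) (a : A)
    (h1 : ∀ y : A, y ≠ a → w a y ≥ v a y)
    (h2 : ∀ x : A, x ≠ a → w x a ≤ v x a)
    (h3 : ∀ x y : A, x ≠ a → y ≠ a → x ≠ y → w x y = v x y)
    (ξ η : A → A → Prop) (hξ : StrictTotal ξ) (hadm : Adm v ξ)
    (hη : StrictTotal η) (hadm' : Adm w η) :
    (∀ y : A, y ≠ a → istar w a y ≥ istar v a y) ∧
    (∀ x : A, x ≠ a → istar w x a ≤ istar v x a) ∧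
    (∀ y : A, y ≠ a → rlr v ξ a < rlr v ξ y → rlr w η a ≤ rlr w η y) ∧
    ((∀ y : A, y ≠ a → rlr v ξ a < rlr v ξ y) →
      ∀ y : A, y ≠ a → rlr w η a < rlr w η y) := by
  have hout : ∀ y : A, y ≠ a → istar w a y ≥ istar v a y :=
    fun y hy => istar_le_istar_left hw h1 h3 hy
  have hin : ∀ x : A, x ≠ a → istar w x a ≤ istar v x a :=
    fun x hx => istar_le_istar_right hv h2 h3 hx
  have hlt : ∀ y : A, y ≠ a → rlr v ξ a < rlr v ξ y → istar w y a < istar w a y :=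
    fun y hy h => (hin y hy).trans_lt ((istar_lt_of_rlr_lt hξ hadm h).trans_le (hout y hy))
  refine ⟨hout, hin, fun y hy h => ?_, fun h y hy => ?_⟩
  · by_contra! h'
    exact (hlt y hy h).asymm (istar_lt_of_rlr_lt hη hadm' h')
  · exact rlr_lt_of_forall_istar_lt hη hadm' (fun z hz => hlt z hz (h z hz)) hy
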